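/- For all positive integers a, b, c with a and b both odd, every type-2 configuration of [a,b,c] admits a proper 8-coloring. -/

import Mathlib

/-- A cuboid with integer root and integer dimensions. -/
structure Cuboid where
  root : ℤ × ℤ × ℤ
  dims : ℤ × ℤ × ℤ
deriving DecidableEq

namespace Cuboid

/-- The dimensions are positive. -/
def valid (C : Cuboid) : Prop :=
  0 < C.dims.1 ∧ 0 < C.dims.2.1 ∧ 0 < C.dims.2.2

/-- The closed cuboid `[x,x+a] × [y,y+b] × [z,z+c] ⊆ ℝ³`. -/
def toSet (C : Cuboid) : Set (ℝ × ℝ × ℝ) :=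
  {p | (C.root.1 : ℝ) ≤ p.1 ∧ p.1 ≤ C.root.1 + C.dims.1 ∧
       (C.root.2.1 : ℝ) ≤ p.2.1 ∧ p.2.1 ≤ C.root.2.1 + C.dims.2.1 ∧
       (C.root.2.2 : ℝ) ≤ p.2.2 ∧ p.2.2 ≤ C.root.2.2 + C.dims.2.2}

/-- The open cuboid `(x,x+a) × (y,y+b) × (z,z+c) ⊆ ℝ³` (the interior). -/
def inte (C : Cuboid) : Set (ℝ × ℝ × ℝ) :=
  {p | (C.root.1 : ℝ) < p.1 ∧ p.1 < C.root.1 + C.dims.1 ∧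
       (C.root.2.1 : ℝ) < p.2.1 ∧ p.2.1 < C.root.2.1 + C.dims.2.1 ∧
       (C.root.2.2 : ℝ) < p.2.2 ∧ p.2.2 < C.root.2.2 + C.dims.2.2}

/-- The set `(ℤ×ℤ×ℝ) ∪ (ℤ×ℝ×ℤ) ∪ (ℝ×ℤ×ℤ)` of grid lines. -/
def grid : Set (ℝ × ℝ × ℝ) :=
  {p | ((∃ m : ℤ, p.1 = m) ∧ (∃ n : ℤ, p.2.1 = n)) ∨
       ((∃ m : ℤ, p.1 = m) ∧ (∃ n : ℤ, p.2.2 = n)) ∨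
       ((∃ m : ℤ, p.2.1 = m) ∧ (∃ n : ℤ, p.2.2 = n))}

/-- Two cuboids collide when their interiors intersect. -/
def Collide (C D : Cuboid) : Prop := (C.inte ∩ D.inte).Nonempty

/-- Two cuboids touch when their interiors are disjoint but their intersection
contains a point outside the grid lines (i.e. it is a non-degenerate rectangle). -/
def Touch (C D : Cuboid) : Prop :=
  ¬ Collide C D ∧ ∃ p ∈ C.toSet ∩ D.toSet, p ∉ grid

end Cuboid

/-- A configuration: a finite family of valid pairwise non-colliding cuboids. -/
def IsConfig (F : Finset Cuboid) : Prop :=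
  (∀ C ∈ F, C.valid) ∧ ∀ C ∈ F, ∀ D ∈ F, C ≠ D → ¬ Cuboid.Collide C D

/-- A type-1 configuration of `[a,b,c]`: every cuboid has dimensions exactly `(a,b,c)`. -/
def Type1 (a b c : ℕ) (F : Finset Cuboid) : Prop :=
  ∀ C ∈ F, C.dims = ((a : ℤ), (b : ℤ), (c : ℤ))

/-- A type-2 configuration of `[a,b,c]`: every cuboid has dimensions `(a,b,c)` or `(b,a,c)`. -/
def Type2 (a b c : ℕ) (F : Finset Cuboid) : Prop :=
  ∀ C ∈ F, C.dims = ((a : ℤ), (b : ℤ), (c : ℤ)) ∨ C.dims = ((b : ℤ), (a : ℤ), (c : ℤ))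

/-- A type-3 configuration of `[a,b,c]`: every cuboid's dimensions are a permutation of `(a,b,c)`. -/
def Type3 (a b c : ℕ) (F : Finset Cuboid) : Prop :=
  ∀ C ∈ F, C.dims = ((a : ℤ), (b : ℤ), (c : ℤ)) ∨ C.dims = ((a : ℤ), (c : ℤ), (b : ℤ)) ∨
    C.dims = ((b : ℤ), (a : ℤ), (c : ℤ)) ∨ C.dims = ((b : ℤ), (c : ℤ), (a : ℤ)) ∨
    C.dims = ((c : ℤ), (a : ℤ), (b : ℤ)) ∨ C.dims = ((c : ℤ), (b : ℤ), (a : ℤ))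

/-- A proper `k`-coloring of a configuration: touching cuboids get distinct colors. -/
def ProperColoring (k : ℕ) (F : Finset Cuboid) : Prop :=
  ∃ κ : Cuboid → Fin k, ∀ C ∈ F, ∀ D ∈ F, Cuboid.Touch C D → κ C ≠ κ D

namespace Cuboid

/-- Non-colliding cuboids are separated along one of the three axes. -/
theorem separated_of_not_collide {C D : Cuboid} (hC : C.valid) (hD : D.valid)
    (h : ¬ Collide C D) :
    (C.root.1 + C.dims.1 ≤ D.root.1 ∨ D.root.1 + D.dims.1 ≤ C.root.1) ∨
    (C.root.2.1 + C.dims.2.1 ≤ D.root.2.1 ∨ D.root.2.1 + D.dims.2.1 ≤ C.root.2.1) ∨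
    (C.root.2.2 + C.dims.2.2 ≤ D.root.2.2 ∨ D.root.2.2 + D.dims.2.2 ≤ C.root.2.2) := by
  have key : ∀ x y l m : ℤ, 0 < l → 0 < m → x < y + m → y < x + l →
      ∃ t : ℝ, ((x : ℝ) < t ∧ t < x + l) ∧ ((y : ℝ) < t ∧ t < y + m) := by
    intro x y l m hl hm h₁ h₂
    obtain ⟨t, ht₁, ht₂⟩ := exists_between
      (show max (x : ℝ) y < min ((x : ℝ) + l) ((y : ℝ) + m) by
        rw [max_lt_iff, lt_min_iff, lt_min_iff]
        norm_cast
        omega)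
    rw [max_lt_iff] at ht₁
    rw [lt_min_iff] at ht₂
    exact ⟨t, ⟨ht₁.1, ht₂.1⟩, ht₁.2, ht₂.2⟩
  contrapose! h
  obtain ⟨⟨hx₁, hx₂⟩, ⟨hy₁, hy₂⟩, hz₁, hz₂⟩ := h
  obtain ⟨x, hxC, hxD⟩ := key _ _ _ _ hC.1 hD.1 hx₂ hx₁
  obtain ⟨y, hyC, hyD⟩ := key _ _ _ _ hC.2.1 hD.2.1 hy₂ hy₁
  obtain ⟨z, hzC, hzD⟩ := key _ _ _ _ hC.2.2 hD.2.2 hz₂ hz₁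
  exact ⟨(x, y, z), ⟨hxC.1, hxC.2, hyC.1, hyC.2, hzC.1, hzC.2⟩,
    hxD.1, hxD.2, hyD.1, hyD.2, hzD.1, hzD.2⟩

/-- Touching cuboids have intersecting projections to every axis. -/
theorem Touch.le {C D : Cuboid} (h : Touch C D) :
    (D.root.1 ≤ C.root.1 + C.dims.1 ∧ C.root.1 ≤ D.root.1 + D.dims.1) ∧
    (D.root.2.1 ≤ C.root.2.1 + C.dims.2.1 ∧ C.root.2.1 ≤ D.root.2.1 + D.dims.2.1) ∧
    (D.root.2.2 ≤ C.root.2.2 + C.dims.2.2 ∧ C.root.2.2 ≤ D.root.2.2 + D.dims.2.2) := by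
  obtain ⟨-, p, ⟨⟨c₁, c₂, c₃, c₄, c₅, c₆⟩, d₁, d₂, d₃, d₄, d₅, d₆⟩, -⟩ := h
  have e₁ := d₁.trans c₂
  have e₂ := c₁.trans d₂
  have e₃ := d₃.trans c₄
  have e₄ := c₃.trans d₄
  have e₅ := d₅.trans c₆
  have e₆ := c₅.trans d₆
  refine ⟨⟨?_, ?_⟩, ⟨?_, ?_⟩, ?_, ?_⟩ <;> assumption_mod_cast

/-- The colour given by the parities of the horizontal root coordinates and of the layer of
height `c` containing the bottom. -/
def parityColor (c : ℕ) (C : Cuboid) : Fin 8 :=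
  ⟨(C.root.1 % 2 + 2 * (C.root.2.1 % 2) + 4 * (C.root.2.2 / c % 2)).toNat, by omega⟩

theorem parityColor_eq {c : ℕ} {C D : Cuboid} (h : parityColor c C = parityColor c D) :
    C.root.1 % 2 = D.root.1 % 2 ∧ C.root.2.1 % 2 = D.root.2.1 % 2 ∧
      C.root.2.2 / (c : ℤ) % 2 = D.root.2.2 / (c : ℤ) % 2 := by
  have h' := congrArg Fin.val h
  simp only [parityColor] at h'
  omega

end Cuboid

/-- Integers at distance at most `c` with `c`-quotients of equal parity have equal quotients,
hence lie at distance less than `c`. -/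
theorem lt_add_of_ediv_parity_eq {c z w : ℤ} (hc : 0 < c) (h₁ : w ≤ z + c) (h₂ : z ≤ w + c)
    (h : z / c % 2 = w / c % 2) : w < z + c ∧ z < w + c := by
  have hw : w / c ≤ z / c + 1 := by
    simpa [Int.add_ediv_of_dvd_right, hc.ne'] using Int.ediv_le_ediv hc h₁
  have hz : z / c ≤ w / c + 1 := by
    simpa [Int.add_ediv_of_dvd_right, hc.ne'] using Int.ediv_le_ediv hc h₂
  have e : z / c = w / c := by omega
  have z₁ := Int.emod_add_mul_ediv z c
  have w₁ := Int.emod_add_mul_ediv w c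
  rw [e] at z₁
  have := Int.emod_nonneg z hc.ne'
  have := Int.emod_nonneg w hc.ne'
  have := Int.emod_lt_of_pos z hc
  have := Int.emod_lt_of_pos w hc
  constructor <;> linarith

/-- For all positive `a, b, c` with `a` and `b` odd, every type-2 configuration of
`[a,b,c]` admits a proper 8-coloring. -/
theorem type2_odd_8colorable (a b c : ℕ) (ha : 0 < a) (hb : 0 < b) (hc : 0 < c)
    (hoa : Odd a) (hob : Odd b) :
    ∀ F : Finset Cuboid, IsConfig F → Type2 a b c F → ProperColoring 8 F := by
  intro F hF hT
  have odd : ∀ C ∈ F, C.dims.1 % 2 = 1 ∧ C.dims.2.1 % 2 = 1 ∧ C.dims.2.2 = c := by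
    intro C hC
    rw [Nat.odd_iff] at hoa hob
    rcases hT C hC with h | h <;> rw [h] <;> refine ⟨?_, ?_, rfl⟩ <;> dsimp only <;> omega
  refine ⟨Cuboid.parityColor c, fun C hC D hD hCD heq => ?_⟩
  obtain ⟨hx, hy, hz⟩ := Cuboid.parityColor_eq heq
  obtain ⟨lx, ly, lz⟩ := hCD.le
  obtain ⟨cx, cy, cz⟩ := odd C hC
  obtain ⟨dx, dy, dz⟩ := odd D hD
  have sep := Cuboid.separated_of_not_collide (hF.1 C hC) (hF.1 D hD) hCD.1
  rw [cz, dz] at lz sep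
  have := lt_add_of_ediv_parity_eq (by exact_mod_cast hc) lz.1 lz.2 hz
  omega
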